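/- arXiv:2005.06642 — 6 statements merged into one kernel-verified Lean document; each statement's English description precedes it below -/
import Mathlib

section
/- Let n be an integer with 2 ≤ n < ∞, H a complex Hilbert space, (S_1, …, S_n) a Cuntz family of order n on H, (T_j)_{j ≥ 1} its associated O_∞ family, R_a, Q the operators built from (T_j), and define U := S_n (I − Q). Then: (i) U* U = I − Q; (ii) U U* = I − Q; (iii) U* R_a = 0 for every integer a ≥ 0; (iv) (U + R_a)* (U + R_a) = I for every integer a ≥ 0; (v) (U + R_a)(U + R_a)* = I − Q + R_a R_a* for every integer a ≥ 0. -/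
open Filter

noncomputable section

variable {H : Type*} [NormedAddCommGroup H] [InnerProductSpace ℂ H] [CompleteSpace H]

/-- A Cuntz family of order `n` on `H` (0-based indexing: `S 0, …, S (n-1)`
correspond to the Cuntz generators `S_1, …, S_n` of `O_n`). -/
def CuntzFamily (n : ℕ) (S : ℕ → H →L[ℂ] H) : Prop :=
  (∀ i < n, ∀ j < n, ContinuousLinearMap.adjoint (S i) * S j = if i = j then 1 else 0) ∧
  ∑ i ∈ Finset.range n, S i * ContinuousLinearMap.adjoint (S i) = 1

/-- An `O_∞` family on `H` (0-based: `t 0, t 1, …` correspond to `t_1, t_2, …`). -/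
def OInfFamily (t : ℕ → H →L[ℂ] H) : Prop :=
  ∀ i j, ContinuousLinearMap.adjoint (t i) * t j = if i = j then 1 else 0

/-- `T` is the associated `O_∞` family of the order-`n` Cuntz family `S`:
`T_{(n-1)k+i} = S_n^k S_i`, i.e. (0-based) `T ((n-1)*k + i) = S (n-1) ^ k * S i`
for `k ≥ 0` and `i < n - 1`.  This corresponds to the embedding
`f_{n,∞} : O_∞ → O_n`, `f_{n,∞}(t_{(n-1)k+i}) = s_n^k s_i`. -/
def IsAssocOInf (n : ℕ) (S T : ℕ → H →L[ℂ] H) : Prop :=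
  ∀ k i, i < n - 1 → T ((n - 1) * k + i) = S (n - 1) ^ k * S i

/-- `R` is the strong-operator-topology sum `R_a = ∑_{j≥1} t_{j+a} t_j*`
(0-based indexing of the family). -/
def IsSOTSum (t : ℕ → H →L[ℂ] H) (a : ℕ) (R : H →L[ℂ] H) : Prop :=
  ∀ x : H,
    Tendsto (fun N => ∑ j ∈ Finset.range N, (t (j + a) * ContinuousLinearMap.adjoint (t j)) x)
      atTop (nhds (R x))



theorem aux_shift (n : ℕ) (hn : 2 ≤ n) (S T : ℕ → H →L[ℂ] H)
    (hT : IsAssocOInf n S T) (j : ℕ) : T (j + (n - 1)) = S (n - 1) * T j := by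
  have hm : 0 < n - 1 := by omega
  have h1 := hT (j / (n-1)) (j % (n-1)) (Nat.mod_lt _ hm)
  have h2 := hT (j / (n-1) + 1) (j % (n-1)) (Nat.mod_lt _ hm)
  rw [Nat.div_add_mod] at h1
  have e : (n-1) * (j / (n-1) + 1) + j % (n-1) = j + (n-1) := by
    have := Nat.div_add_mod j (n-1)
    rw [mul_add, mul_one]; omega
  rw [e] at h2
  rw [h2, h1, pow_succ', mul_assoc]

theorem aux_init (n : ℕ) (S T : ℕ → H →L[ℂ] H)
    (hT : IsAssocOInf n S T) (j : ℕ) (hj : j < n - 1) : T j = S j := by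
  simpa using hT 0 j hj

theorem aux_adj_mul (A B : H →L[ℂ] H) : ContinuousLinearMap.adjoint (A * B) = ContinuousLinearMap.adjoint B * ContinuousLinearMap.adjoint A :=
  ContinuousLinearMap.adjoint_comp A B

theorem aux_adj_one : ContinuousLinearMap.adjoint (1 : H →L[ℂ] H) = 1 := by
  rw [← ContinuousLinearMap.star_eq_adjoint, star_one]

theorem aux_orth (n : ℕ) (hn : 2 ≤ n) (S T : ℕ → H →L[ℂ] H)
    (hS : CuntzFamily n S) (hT : IsAssocOInf n S T) : OInfFamily T := by
  have key : ∀ i j, i ≤ j → ContinuousLinearMap.adjoint (T i) * T j = if i = j then 1 else 0 := by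
    intro i
    induction i using Nat.strong_induction_on with
    | _ i ih =>
      intro j hij
      by_cases hj : j < n - 1
      · rw [aux_init n S T hT i (by omega), aux_init n S T hT j hj]
        exact hS.1 i (by omega) j (by omega)
      · obtain ⟨j', rfl⟩ : ∃ j', j = j' + (n-1) := ⟨j - (n-1), by omega⟩
        rw [aux_shift n hn S T hT j']
        by_cases hi : i < n - 1
        · rw [aux_init n S T hT i hi, ← mul_assoc, hS.1 i (by omega) (n-1) (by omega),
            if_neg (by omega), if_neg (by omega), zero_mul]
        · obtain ⟨i', rfl⟩ : ∃ i', i = i' + (n-1) := ⟨i - (n-1), by omega⟩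
          rw [aux_shift n hn S T hT i', aux_adj_mul, mul_assoc, ← mul_assoc _ (S (n-1)),
            hS.1 (n-1) (by omega) (n-1) (by omega), if_pos rfl, one_mul,
            ih i' (by omega) j' (by omega)]
          simp
  intro i j
  rcases le_total i j with h | h
  · exact key i j h
  · have := congrArg (fun A => ContinuousLinearMap.adjoint A) (key j i h)
    simp only [aux_adj_mul, ContinuousLinearMap.adjoint_adjoint] at this
    rw [this]
    by_cases e : j = i
    · subst e; rw [if_pos rfl]; exact aux_adj_one
    · rw [if_neg e, if_neg (Ne.symm e)]; simp

theorem aux_left (T : ℕ → H →L[ℂ] H) (a b : ℕ) (R A R' : H →L[ℂ] H)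
    (hR : IsSOTSum T a R) (hR' : IsSOTSum T b R')
    (h : ∀ j, A * T (j + a) = T (j + b)) : A * R = R' := by
  ext x
  refine tendsto_nhds_unique ((A.continuous.tendsto _).comp (hR x)) ?_
  refine (hR' x).congr fun N => ?_
  simp only [Function.comp, map_sum]
  refine Finset.sum_congr rfl fun j _ => ?_
  rw [← h j]; rfl

theorem aux_adjT (T : ℕ → H →L[ℂ] H) (hO : OInfFamily T) (a k : ℕ) (R : H →L[ℂ] H)
    (hR : IsSOTSum T a R) : ContinuousLinearMap.adjoint (T (k + a)) * R = ContinuousLinearMap.adjoint (T k) := by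
  ext x
  refine tendsto_nhds_unique (((ContinuousLinearMap.adjoint (T (k+a))).continuous.tendsto _).comp (hR x)) ?_
  refine tendsto_const_nhds.congr' ?_
  filter_upwards [eventually_gt_atTop k] with N hN
  simp only [Function.comp, map_sum]
  rw [Finset.sum_eq_single_of_mem k (Finset.mem_range.2 hN)]
  · change _ = (ContinuousLinearMap.adjoint (T (k+a)) * T (k+a)) (ContinuousLinearMap.adjoint (T k) x)
    rw [hO, if_pos rfl]; rfl
  · intro j _ hj
    change (ContinuousLinearMap.adjoint (T (k+a)) * T (j+a)) (ContinuousLinearMap.adjoint (T j) x) = 0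
    rw [hO, if_neg (by omega)]; rfl

theorem aux_RT (T : ℕ → H →L[ℂ] H) (hO : OInfFamily T) (a k : ℕ) (R : H →L[ℂ] H)
    (hR : IsSOTSum T a R) : R * T k = T (k + a) := by
  ext x
  refine tendsto_nhds_unique (hR (T k x)) ?_
  refine tendsto_const_nhds.congr' ?_
  filter_upwards [eventually_gt_atTop k] with N hN
  rw [Finset.sum_eq_single_of_mem k (Finset.mem_range.2 hN)]
  · change _ = T (k+a) ((ContinuousLinearMap.adjoint (T k) * T k) x)
    rw [hO, if_pos rfl]; rfl
  · intro j _ hj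
    change T (j+a) ((ContinuousLinearMap.adjoint (T j) * T k) x) = 0
    rw [hO, if_neg (by omega)]; simp

theorem aux_VQV (n : ℕ) (hn : 2 ≤ n) (S T : ℕ → H →L[ℂ] H)
    (hT : IsAssocOInf n S T) (Q : H →L[ℂ] H) (hQ : IsSOTSum T 0 Q) :
    S (n-1) * Q * ContinuousLinearMap.adjoint (S (n-1)) + ∑ j ∈ Finset.range (n-1), S j * ContinuousLinearMap.adjoint (S j) = Q := by
  ext x
  have h1 := ((S (n-1)).continuous.tendsto _).comp (hQ (ContinuousLinearMap.adjoint (S (n-1)) x))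
  have h2 := h1.add_const ((∑ j ∈ Finset.range (n-1), S j * ContinuousLinearMap.adjoint (S j)) x)
  refine tendsto_nhds_unique h2 ?_
  refine ((tendsto_add_atTop_iff_nat (n-1)).2 (hQ x)).congr fun N => ?_
  rw [add_comm N, Finset.sum_range_add, add_comm]
  congr 1
  · simp only [Function.comp, map_sum]
    refine Finset.sum_congr rfl fun j _ => ?_
    simp only [add_zero]
    rw [add_comm (n-1) j, aux_shift n hn S T hT, aux_adj_mul]
    rfl
  · rw [sum_apply]
    refine Finset.sum_congr rfl fun j hj => ?_
    rw [add_zero, aux_init n S T hT j (Finset.mem_range.1 hj)]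

theorem stmt8 (n : ℕ) (hn : 2 ≤ n) (S T : ℕ → H →L[ℂ] H)
    (hS : CuntzFamily n S) (hT : IsAssocOInf n S T)
    (R : ℕ → H →L[ℂ] H) (hR : ∀ a, IsSOTSum T a (R a))
    (U : H →L[ℂ] H) (hU : U = S (n - 1) * (1 - R 0)) :
    ContinuousLinearMap.adjoint U * U = 1 - R 0 ∧
    U * ContinuousLinearMap.adjoint U = 1 - R 0 ∧
    (∀ a, ContinuousLinearMap.adjoint U * R a = 0) ∧
    (∀ a, ContinuousLinearMap.adjoint (U + R a) * (U + R a) = 1) ∧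
    (∀ a, (U + R a) * ContinuousLinearMap.adjoint (U + R a) =
      1 - R 0 + R a * ContinuousLinearMap.adjoint (R a)) := by
  have hO := aux_orth n hn S T hS hT
  have hRR : ∀ a, ContinuousLinearMap.adjoint (R a) * R a = R 0 := fun a =>
    aux_left T a 0 (R a) _ (R 0) (hR a) (hR 0) fun j => by
      have := congrArg (fun A => ContinuousLinearMap.adjoint A) (aux_adjT T hO a j (R a) (hR a))
      simpa only [aux_adj_mul, add_zero, ContinuousLinearMap.adjoint_adjoint] using this
  have hQs : ContinuousLinearMap.adjoint (R 0) = R 0 := by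
    have := congrArg (fun A => ContinuousLinearMap.adjoint A) (hRR 0)
    simp only [aux_adj_mul, ContinuousLinearMap.adjoint_adjoint] at this
    rw [← this, hRR 0]
  have hQR : ∀ a, R 0 * R a = R a := fun a =>
    aux_left T a a (R a) _ (R a) (hR a) (hR a) fun j => aux_RT T hO 0 (j + a) (R 0) (hR 0)
  have hRQ : ∀ a, R a * R 0 = R a := fun a =>
    aux_left T 0 a (R 0) _ (R a) (hR 0) (hR a) fun j => aux_RT T hO a j (R a) (hR a)
  have hQRs : ∀ a, R 0 * ContinuousLinearMap.adjoint (R a) = ContinuousLinearMap.adjoint (R a) := fun a => by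
    have := congrArg (fun A => ContinuousLinearMap.adjoint A) (hRQ a)
    simpa only [aux_adj_mul, hQs] using this
  have hVV : ContinuousLinearMap.adjoint (S (n-1)) * S (n-1) = 1 := by
    rw [hS.1 (n-1) (by omega) (n-1) (by omega), if_pos rfl]
  have hsum : ∑ j ∈ Finset.range (n-1), S j * ContinuousLinearMap.adjoint (S j) + S (n-1) * ContinuousLinearMap.adjoint (S (n-1)) = 1 := by
    rw [← hS.2, ← Finset.sum_range_succ, show n - 1 + 1 = n by omega]
  have hVQV := aux_VQV n hn S T hT (R 0) (hR 0)
  have h1s : ContinuousLinearMap.adjoint (1 : H →L[ℂ] H) = 1 := aux_adj_one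
  have hUs : ContinuousLinearMap.adjoint U = (1 - R 0) * ContinuousLinearMap.adjoint (S (n-1)) := by
    rw [hU, aux_adj_mul, map_sub, hQs, h1s]
  have hP : (1 - R 0) * (1 - R 0) = 1 - R 0 := by
    rw [mul_sub, mul_one, sub_mul, one_mul, hQR 0]; abel
  have i1 : ContinuousLinearMap.adjoint U * U = 1 - R 0 := by
    rw [hUs, hU, mul_assoc, ← mul_assoc (ContinuousLinearMap.adjoint _), hVV, one_mul, hP]
  have i2 : U * ContinuousLinearMap.adjoint U = 1 - R 0 := by
    rw [hUs, hU, mul_assoc, ← mul_assoc (1 - R 0), hP, sub_mul, one_mul, mul_sub, ← mul_assoc]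
    rw [eq_sub_of_add_eq hVQV, eq_sub_of_add_eq' hsum]; abel
  have hUQ : U * (1 - R 0) = U := by rw [hU, mul_assoc, hP]
  have hQU : ContinuousLinearMap.adjoint U * (1 - R 0) = ContinuousLinearMap.adjoint U := by
    have h : (1 - R 0) * U = U := by rw [← i2, mul_assoc, i1, hUQ]
    have := congrArg (fun A => ContinuousLinearMap.adjoint A) h
    simpa only [aux_adj_mul, map_sub, hQs, h1s] using this
  have i3 : ∀ a, ContinuousLinearMap.adjoint U * R a = 0 := fun a => by
    rw [← hQU, mul_assoc, sub_mul, one_mul, hQR, sub_self, mul_zero]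
  have i3' : ∀ a, ContinuousLinearMap.adjoint (R a) * U = 0 := fun a => by
    have := congrArg (fun A => ContinuousLinearMap.adjoint A) (i3 a)
    simpa only [aux_adj_mul, ContinuousLinearMap.adjoint_adjoint, map_zero] using this
  have i4 : ∀ a, U * ContinuousLinearMap.adjoint (R a) = 0 := fun a => by
    rw [← hUQ, mul_assoc, sub_mul, one_mul, hQRs, sub_self, mul_zero]
  have i4' : ∀ a, R a * ContinuousLinearMap.adjoint U = 0 := fun a => by
    have := congrArg (fun A => ContinuousLinearMap.adjoint A) (i4 a)
    simpa only [aux_adj_mul, ContinuousLinearMap.adjoint_adjoint, map_zero] using this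
  refine ⟨i1, i2, i3, fun a => ?_, fun a => ?_⟩
  · rw [map_add, add_mul, mul_add, mul_add, i1, i3, i3', hRR]; abel
  · rw [map_add, add_mul, mul_add, mul_add, i2, i4, i4']; abel
end
end

section
/- Let n, m be integers with 2 ≤ n, m < ∞, H a nonzero complex Hilbert space, and (r_1, …, r_m) a Cuntz family of order m on H with associated O_∞ family (T_j)_{j ≥ 1} and operators R_a, Q. Define S_i := T_i for i = 1, …, n−1 and S_n := r_m(I − Q) + R_{n−1}. Then (S_1, …, S_n) is a Cuntz family of order n on H, i.e. S_i* S_j = δ_{ij}·I for all i, j = 1, …, n and S_1 S_1* + ⋯ + S_n S_n* = I. -/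
open Filter

noncomputable section

variable {H : Type*} [NormedAddCommGroup H] [InnerProductSpace ℂ H] [CompleteSpace H]

def LSum (f : ℕ → H →L[ℂ] H) (B : H →L[ℂ] H) : Prop :=
  ∀ x : H, Tendsto (fun N => ∑ j ∈ Finset.range N, (f j) x) atTop (nhds (B x))

theorem LSum.uniq {f : ℕ → H →L[ℂ] H} {B C : H →L[ℂ] H} (h : LSum f B) (h' : LSum f C) :
    B = C := by
  ext x
  exact tendsto_nhds_unique (h x) (h' x)

theorem LSum.mul_left {f : ℕ → H →L[ℂ] H} {B : H →L[ℂ] H} (h : LSum f B) (C : H →L[ℂ] H) :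
    LSum (fun j => C * f j) (C * B) := by
  intro x
  have := (C.continuous.tendsto (B x)).comp (h x)
  refine this.congr ?_
  intro N
  simp [map_sum]

theorem LSum.mul_right {f : ℕ → H →L[ℂ] H} {B : H →L[ℂ] H} (h : LSum f B) (C : H →L[ℂ] H) :
    LSum (fun j => f j * C) (B * C) := by
  intro x
  exact h (C x)

theorem LSum.single (i : ℕ) (X : H →L[ℂ] H) : LSum (fun j => if j = i then X else 0) X := by
  intro x
  refine tendsto_const_nhds.congr' ?_
  filter_upwards [eventually_gt_atTop i] with N hN
  rw [Finset.sum_eq_single i]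
  · simp
  · intro b _ hb; simp [hb]
  · intro h; exact absurd (Finset.mem_range.2 hN) h

theorem LSum.zero : LSum (fun _ => (0 : H →L[ℂ] H)) 0 := by
  intro x
  simp

theorem LSum.shift {f : ℕ → H →L[ℂ] H} {B : H →L[ℂ] H} (h : LSum f B) (a : ℕ) :
    LSum (fun j => f (j + a)) (B - ∑ i ∈ Finset.range a, f i) := by
  intro x
  have h1 := ((tendsto_add_atTop_iff_nat a).2 (h x)).sub_const ((∑ i ∈ Finset.range a, f i) x)
  refine h1.congr ?_
  intro N
  rw [add_comm N a, Finset.sum_range_add, ContinuousLinearMap.sum_apply, add_sub_cancel_left]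
  exact Finset.sum_congr rfl fun j _ => by rw [add_comm]

section
variable {T : ℕ → H →L[ℂ] H} {R : ℕ → H →L[ℂ] H}

theorem R_mul_T (hO : ∀ i j, star (T i) * T j = if i = j then 1 else 0)
    (hR : ∀ a, LSum (fun j => T (j + a) * star (T j)) (R a)) (a j : ℕ) :
    R a * T j = T (j + a) := by
  refine ((hR a).mul_right (T j)).uniq ?_
  convert LSum.single j (T (j + a)) using 2 with i
  rw [mul_assoc, hO]
  split_ifs with h
  · rw [h, mul_one]
  · simp

theorem T_mul_R (hO : ∀ i j, star (T i) * T j = if i = j then 1 else 0)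
    (hR : ∀ a, LSum (fun j => T (j + a) * star (T j)) (R a)) (a j : ℕ) :
    star (T (j + a)) * R a = star (T j) := by
  refine ((hR a).mul_left (star (T (j + a)))).uniq ?_
  convert LSum.single j (star (T j)) using 2 with i
  rw [← mul_assoc, hO]
  by_cases h : i = j
  · simp [h]
  · rw [if_neg h, if_neg (by omega), zero_mul]

theorem T_mul_R_lt (hO : ∀ i j, star (T i) * T j = if i = j then 1 else 0)
    (hR : ∀ a, LSum (fun j => T (j + a) * star (T j)) (R a)) (a j : ℕ) (hj : j < a) :
    star (T j) * R a = 0 := by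
  refine ((hR a).mul_left (star (T j))).uniq ?_
  convert LSum.zero (H := H) using 2 with i
  rw [← mul_assoc, hO, if_neg (by omega), zero_mul]

theorem R_star (hO : ∀ i j, star (T i) * T j = if i = j then 1 else 0)
    (hR : ∀ a, LSum (fun j => T (j + a) * star (T j)) (R a)) (a : ℕ) :
    R a * star (R a) = R 0 - ∑ i ∈ Finset.range a, T i * star (T i) := by
  refine ((hR a).mul_right (star (R a))).uniq ?_
  have h := (hR 0).shift a
  simp only [add_zero] at h
  convert h using 2 with i
  rw [mul_assoc, ← star_mul, R_mul_T hO hR]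

theorem star_R (hO : ∀ i j, star (T i) * T j = if i = j then 1 else 0)
    (hR : ∀ a, LSum (fun j => T (j + a) * star (T j)) (R a)) (a : ℕ) :
    star (R a) * R a = R 0 := by
  refine ((hR a).mul_left (star (R a))).uniq ?_
  convert hR 0 using 2 with i
  rw [← mul_assoc, ← star_star (T (i + a)), ← star_mul, T_mul_R hO hR, star_star, add_zero]

theorem Q_R (hO : ∀ i j, star (T i) * T j = if i = j then 1 else 0)
    (hR : ∀ a, LSum (fun j => T (j + a) * star (T j)) (R a)) (a : ℕ) :
    R 0 * R a = R a := by
  refine ((hR a).mul_left (R 0)).uniq ?_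
  convert hR a using 2 with i
  rw [← mul_assoc, R_mul_T hO hR, add_zero]

theorem R_Q (hO : ∀ i j, star (T i) * T j = if i = j then 1 else 0)
    (hR : ∀ a, LSum (fun j => T (j + a) * star (T j)) (R a)) (a : ℕ) :
    R a * R 0 = R a := by
  refine ((hR a).mul_right (R 0)).uniq ?_
  convert hR a using 2 with i
  have := T_mul_R hO hR 0 i
  rw [add_zero] at this
  rw [mul_assoc, this]

end

theorem stmt10 [Nontrivial H] (n m : ℕ) (hn : 2 ≤ n) (hm : 2 ≤ m)
    (r T : ℕ → H →L[ℂ] H) (hr : CuntzFamily m r) (hT : IsAssocOInf m r T)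
    (R : ℕ → H →L[ℂ] H) (hR : ∀ a, IsSOTSum T a (R a))
    (S : ℕ → H →L[ℂ] H) (hS₁ : ∀ i < n - 1, S i = T i)
    (hS₂ : S (n - 1) = r (m - 1) * (1 - R 0) + R (n - 1)) :
    CuntzFamily n S := by
  obtain ⟨p, rfl⟩ : ∃ p, m = p + 1 := ⟨m - 1, by omega⟩
  obtain ⟨a, rfl⟩ : ∃ a, n = a + 1 := ⟨n - 1, by omega⟩
  obtain ⟨hr1, hr2⟩ := hr
  unfold IsAssocOInf at hT
  simp only [Nat.add_sub_cancel] at hT hS₁ hS₂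
  simp only [← ContinuousLinearMap.star_eq_adjoint] at hr1 hr2
  replace hR : ∀ a, LSum (fun j => T (j + a) * star (T j)) (R a) := hR
  have hT0 : ∀ i < p, T i = r i := fun i hi => by simpa using hT 0 i hi
  have hp : 0 < p := by omega
  have hTV : ∀ j, T (j + p) = r p * T j := by
    intro j
    have h1 := hT (j / p) (j % p) (Nat.mod_lt _ hp)
    have h2 := hT (j / p + 1) (j % p) (Nat.mod_lt _ hp)
    rw [Nat.div_add_mod] at h1
    rw [mul_add, mul_one, add_right_comm, Nat.div_add_mod] at h2
    rw [h1, h2, pow_succ', mul_assoc]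
  have hVV : star (r p) * r p = 1 := by simpa using hr1 p (by omega) p (by omega)
  have hO : ∀ i j, star (T i) * T j = if i = j then 1 else 0 := by
    intro i
    induction i using Nat.strong_induction_on with
    | _ i ih =>
      intro j
      rcases lt_or_ge i p with hi | hi <;> rcases lt_or_ge j p with hj | hj
      · rw [hT0 i hi, hT0 j hj, hr1 i (by omega) j (by omega)]
      · obtain ⟨j, rfl⟩ := Nat.exists_eq_add_of_le' hj
        rw [hT0 i hi, hTV, ← mul_assoc, hr1 i (by omega) p (by omega), if_neg (by omega),
          if_neg (by omega), zero_mul]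
      · obtain ⟨i, rfl⟩ := Nat.exists_eq_add_of_le' hi
        rw [hT0 j hj, hTV, star_mul, mul_assoc, hr1 p (by omega) j (by omega), if_neg (by omega),
          if_neg (by omega), mul_zero]
      · obtain ⟨i, rfl⟩ := Nat.exists_eq_add_of_le' hi
        obtain ⟨j, rfl⟩ := Nat.exists_eq_add_of_le' hj
        rw [hTV, hTV, star_mul, mul_assoc, ← mul_assoc (star (r p)), hVV, one_mul,
          ih i (by omega)]
        simp
  set V := r p with hV
  set Q := R 0 with hQ
  set A := R a with hA
  have hQs : star Q = Q := by
    have := R_star hO hR 0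
    rw [← hQ, Finset.range_zero, Finset.sum_empty, sub_zero] at this
    rw [← this, star_mul, star_star]
  have hQQ : Q * Q = Q := Q_R hO hR 0
  have hVQV : V * Q * star V = Q - (1 - V * star V) := by
    have h1 : LSum (fun j => V * (T (j + 0) * star (T j)) * star V) (V * Q * star V) :=
      ((hR 0).mul_left V).mul_right (star V)
    refine h1.uniq ?_
    have h2 := (hR 0).shift p
    rw [Finset.sum_range_succ] at hr2
    have h3 : ∑ i ∈ Finset.range p, T (i + 0) * star (T i) = 1 - V * star V := by
      rw [← hr2, add_sub_cancel_right]
      exact Finset.sum_congr rfl fun i hi => by rw [add_zero, hT0 i (Finset.mem_range.1 hi)]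
    rw [h3] at h2
    convert h2 using 2 with i
    simp only [add_zero, hTV, star_mul, mul_assoc]
  have hVPV : V * (1 - Q) * star V = 1 - Q := by
    rw [mul_sub, sub_mul, hVQV, mul_one]; abel
  have hcomm : V * (1 - Q) = (1 - Q) * V := by
    conv_rhs => rw [← hVPV]
    rw [mul_assoc _ (star V), hVV, mul_one]
  have hPs : star (1 - Q) = 1 - Q := by rw [star_sub, star_one, hQs]
  have hPP : (1 - Q) * (1 - Q) = 1 - Q := by
    rw [mul_sub, mul_one, sub_mul, one_mul, hQQ]; abel
  have hPA : (1 - Q) * A = 0 := by rw [sub_mul, one_mul, Q_R hO hR, sub_self]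
  have hAP : A * (1 - Q) = 0 := by rw [mul_sub, mul_one, R_Q hO hR, sub_self]
  have hAsP : star A * (1 - Q) = 0 := by
    have := congrArg star hPA
    rwa [star_mul, hPs, star_zero] at this
  have hPAs : (1 - Q) * star A = 0 := by
    have := congrArg star hAP
    rwa [star_mul, hPs, star_zero] at this
  have hTP : ∀ j, star (T j) * (1 - Q) = 0 := by
    intro j
    have := T_mul_R hO hR 0 j
    rw [add_zero] at this
    rw [mul_sub, this, mul_one, sub_self]
  have hTW : ∀ i < a, star (T i) * S a = 0 := by
    intro i hi
    rw [hS₂, mul_add, T_mul_R_lt hO hR a i hi, hcomm, ← mul_assoc, hTP, zero_mul, add_zero]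
  have hWs : star (S a) = star V * (1 - Q) + star A := by
    rw [hS₂, hcomm, star_add, star_mul, hPs]
  have hWs' : star (S a) = (1 - Q) * star V + star A := by
    rw [hS₂, star_add, star_mul, hPs]
  have hWW : star (S a) * S a = 1 := by
    have e1 : star V * (1 - Q) * (V * (1 - Q)) = 1 - Q := by
      rw [mul_assoc, ← mul_assoc (1 - Q) V, ← hcomm, mul_assoc V, hPP, ← mul_assoc, hVV, one_mul]
    have e2 : star V * (1 - Q) * A = 0 := by rw [mul_assoc, hPA, mul_zero]
    have e3 : star A * (V * (1 - Q)) = 0 := by rw [hcomm, ← mul_assoc, hAsP, zero_mul]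
    rw [hWs, hS₂, add_mul, mul_add, mul_add, e1, e2, e3, star_R hO hR a]
    abel
  have hWW' : S a * star (S a) = 1 - ∑ i ∈ Finset.range a, T i * star (T i) := by
    have e1 : V * (1 - Q) * ((1 - Q) * star V) = 1 - Q := by
      rw [← mul_assoc, mul_assoc V, hPP, hVPV]
    have e2 : V * (1 - Q) * star A = 0 := by rw [mul_assoc, hPAs, mul_zero]
    have e3 : A * ((1 - Q) * star V) = 0 := by rw [← mul_assoc, hAP, zero_mul]
    rw [hWs', hS₂, add_mul, mul_add, mul_add, e1, e2, e3, R_star hO hR a]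
    abel
  unfold CuntzFamily
  simp only [← ContinuousLinearMap.star_eq_adjoint]
  constructor
  · intro i hi j hj
    rcases Nat.lt_succ_iff_lt_or_eq.1 hi with hi | rfl <;>
    rcases Nat.lt_succ_iff_lt_or_eq.1 hj with hj | rfl
    · rw [hS₁ i hi, hS₁ j hj, hO]
    · rw [hS₁ i hi, hTW i hi, if_neg (by omega)]
    · have := congrArg star (hTW j hj)
      rw [star_mul, star_star, star_zero] at this
      rw [hS₁ j hj, this, if_neg (by omega)]
    · rw [hWW, if_pos rfl]
  · rw [Finset.sum_range_succ, hWW', Finset.sum_congr rfl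
      (fun i hi => by rw [hS₁ i (Finset.mem_range.1 hi)])]
    abel
end
end

section
/- Let n, m be integers with 2 ≤ n, m < ∞. For k = 1, 2 let (r_1^{(k)}, …, r_m^{(k)}) be a Cuntz family of order m on a complex Hilbert space H_k, and let (S_1^{(k)}, …, S_n^{(k)}) be the induced Cuntz family of order n on H_k. If a bounded linear operator W: H_1 → H_2 intertwines (r_i^{(1)}) and (r_i^{(2)}) (i.e. W r_i^{(1)} = r_i^{(2)} W and W (r_i^{(1)})* = (r_i^{(2)})* W for all i = 1, …, m), then W intertwines (S_i^{(1)}) and (S_i^{(2)}) (i.e. W S_i^{(1)} = S_i^{(2)} W and W (S_i^{(1)})* = (S_i^{(2)})* W for all i = 1, …, n). -/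
open Filter

noncomputable section

variable {H : Type*} [NormedAddCommGroup H] [InnerProductSpace ℂ H] [CompleteSpace H]

theorem aux_half {H₁ H₂ : Type*}
    [NormedAddCommGroup H₁] [InnerProductSpace ℂ H₁] [CompleteSpace H₁]
    [NormedAddCommGroup H₂] [InnerProductSpace ℂ H₂] [CompleteSpace H₂]
    (n m : ℕ) (hm : 2 ≤ m)
    (r₁ T₁ R₁' : ℕ → H₁ →L[ℂ] H₁) (r₂ T₂ R₂' : ℕ → H₂ →L[ℂ] H₂)
    (hT₁ : IsAssocOInf m r₁ T₁) (hR₁ : ∀ a, IsSOTSum T₁ a (R₁' a))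
    (hT₂ : IsAssocOInf m r₂ T₂) (hR₂ : ∀ a, IsSOTSum T₂ a (R₂' a))
    (S₁ : ℕ → H₁ →L[ℂ] H₁) (hS₁₁ : ∀ i < n - 1, S₁ i = T₁ i)
    (hS₁₂ : S₁ (n - 1) = r₁ (m - 1) * (1 - R₁' 0) + R₁' (n - 1))
    (S₂ : ℕ → H₂ →L[ℂ] H₂) (hS₂₁ : ∀ i < n - 1, S₂ i = T₂ i)
    (hS₂₂ : S₂ (n - 1) = r₂ (m - 1) * (1 - R₂' 0) + R₂' (n - 1))
    (W : H₁ →L[ℂ] H₂)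
    (hW : ∀ i < m, W ∘L r₁ i = r₂ i ∘L W ∧
      W ∘L ContinuousLinearMap.adjoint (r₁ i) = ContinuousLinearMap.adjoint (r₂ i) ∘L W) :
    ∀ i < n, W ∘L S₁ i = S₂ i ∘L W := by
  have h1 : ∀ i < m, ∀ x, W (r₁ i x) = r₂ i (W x) := fun i hi x =>
    DFunLike.congr_fun (hW i hi).1 x
  have h2 : ∀ i < m, ∀ x, W (ContinuousLinearMap.adjoint (r₁ i) x)
      = ContinuousLinearMap.adjoint (r₂ i) (W x) := fun i hi x =>
    DFunLike.congr_fun (hW i hi).2 x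
  have hp : ∀ k x, W ((r₁ (m-1) ^ k) x) = (r₂ (m-1) ^ k) (W x) := by
    intro k
    induction k with
    | zero => intro x; simp
    | succ k ih =>
      intro x
      rw [pow_succ, pow_succ, ContinuousLinearMap.mul_apply, ContinuousLinearMap.mul_apply, ih,
        h1 _ (by omega)]
  have hpa : ∀ k x, W (ContinuousLinearMap.adjoint (r₁ (m-1) ^ k) x)
      = ContinuousLinearMap.adjoint (r₂ (m-1) ^ k) (W x) := by
    intro k
    induction k with
    | zero => intro x; simp [← ContinuousLinearMap.star_eq_adjoint]
    | succ k ih =>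
      intro x
      have e1 : ContinuousLinearMap.adjoint (r₁ (m-1) ^ (k+1)) =
        ContinuousLinearMap.adjoint (r₁ (m-1)) * ContinuousLinearMap.adjoint (r₁ (m-1) ^ k) := by
        simp only [← ContinuousLinearMap.star_eq_adjoint]; rw [pow_succ, star_mul]
      have e2 : ContinuousLinearMap.adjoint (r₂ (m-1) ^ (k+1)) =
        ContinuousLinearMap.adjoint (r₂ (m-1)) * ContinuousLinearMap.adjoint (r₂ (m-1) ^ k) := by
        simp only [← ContinuousLinearMap.star_eq_adjoint]; rw [pow_succ, star_mul]
      rw [e1, e2, ContinuousLinearMap.mul_apply, ContinuousLinearMap.mul_apply,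
        h2 _ (by omega), ih]
  have hT : ∀ j, (∀ x, W (T₁ j x) = T₂ j (W x)) ∧
      ∀ x, W (ContinuousLinearMap.adjoint (T₁ j) x)
        = ContinuousLinearMap.adjoint (T₂ j) (W x) := by
    intro j
    have hlt : j % (m-1) < m-1 := Nat.mod_lt _ (by omega)
    have a1 := hT₁ (j / (m-1)) (j % (m-1)) hlt
    have a2 := hT₂ (j / (m-1)) (j % (m-1)) hlt
    rw [Nat.div_add_mod] at a1 a2
    have e1 : ContinuousLinearMap.adjoint (T₁ j) =
        ContinuousLinearMap.adjoint (r₁ (j % (m-1))) *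
          ContinuousLinearMap.adjoint (r₁ (m-1) ^ (j / (m-1))) := by
      rw [a1]; simp only [← ContinuousLinearMap.star_eq_adjoint]; rw [star_mul]
    have e2 : ContinuousLinearMap.adjoint (T₂ j) =
        ContinuousLinearMap.adjoint (r₂ (j % (m-1))) *
          ContinuousLinearMap.adjoint (r₂ (m-1) ^ (j / (m-1))) := by
      rw [a2]; simp only [← ContinuousLinearMap.star_eq_adjoint]; rw [star_mul]
    constructor
    · intro x
      rw [a1, a2, ContinuousLinearMap.mul_apply, ContinuousLinearMap.mul_apply, hp,
        h1 _ (by omega)]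
    · intro x
      rw [e1, e2, ContinuousLinearMap.mul_apply, ContinuousLinearMap.mul_apply,
        h2 _ (by omega), hpa]
  have hR : ∀ a x, W (R₁' a x) = R₂' a (W x) := by
    intro a x
    refine tendsto_nhds_unique ((W.continuous.tendsto _).comp (hR₁ a x)) ?_
    refine (hR₂ a (W x)).congr fun N => ?_
    simp only [Function.comp, map_sum, ContinuousLinearMap.mul_apply]
    refine Finset.sum_congr rfl fun j _ => ?_
    rw [(hT _).1, (hT _).2]
  intro i hi
  ext x
  rcases Nat.lt_or_ge i (n-1) with h | h
  · simp only [ContinuousLinearMap.comp_apply]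
    rw [hS₁₁ i h, hS₂₁ i h, (hT i).1]
  · obtain rfl : i = n - 1 := by omega
    simp only [ContinuousLinearMap.comp_apply]
    rw [hS₁₂, hS₂₂]
    simp only [ContinuousLinearMap.add_apply, ContinuousLinearMap.mul_apply,
      ContinuousLinearMap.sub_apply, ContinuousLinearMap.one_apply, map_add]
    rw [h1 _ (by omega), map_sub, hR, hR]

theorem stmt11 {H₁ H₂ : Type*}
    [NormedAddCommGroup H₁] [InnerProductSpace ℂ H₁] [CompleteSpace H₁]
    [NormedAddCommGroup H₂] [InnerProductSpace ℂ H₂] [CompleteSpace H₂]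
    (n m : ℕ) (hn : 2 ≤ n) (hm : 2 ≤ m)
    (r₁ T₁ R₁' : ℕ → H₁ →L[ℂ] H₁) (r₂ T₂ R₂' : ℕ → H₂ →L[ℂ] H₂)
    (hr₁ : CuntzFamily m r₁) (hT₁ : IsAssocOInf m r₁ T₁) (hR₁ : ∀ a, IsSOTSum T₁ a (R₁' a))
    (hr₂ : CuntzFamily m r₂) (hT₂ : IsAssocOInf m r₂ T₂) (hR₂ : ∀ a, IsSOTSum T₂ a (R₂' a))
    (S₁ : ℕ → H₁ →L[ℂ] H₁) (hS₁₁ : ∀ i < n - 1, S₁ i = T₁ i)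
    (hS₁₂ : S₁ (n - 1) = r₁ (m - 1) * (1 - R₁' 0) + R₁' (n - 1))
    (S₂ : ℕ → H₂ →L[ℂ] H₂) (hS₂₁ : ∀ i < n - 1, S₂ i = T₂ i)
    (hS₂₂ : S₂ (n - 1) = r₂ (m - 1) * (1 - R₂' 0) + R₂' (n - 1))
    (W : H₁ →L[ℂ] H₂)
    (hW : ∀ i < m, W ∘L r₁ i = r₂ i ∘L W ∧
      W ∘L ContinuousLinearMap.adjoint (r₁ i) = ContinuousLinearMap.adjoint (r₂ i) ∘L W) :
    ∀ i < n, W ∘L S₁ i = S₂ i ∘L W ∧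
      W ∘L ContinuousLinearMap.adjoint (S₁ i) = ContinuousLinearMap.adjoint (S₂ i) ∘L W := by
  intro i hi
  refine ⟨aux_half n m hm r₁ T₁ R₁' r₂ T₂ R₂' hT₁ hR₁ hT₂ hR₂ S₁ hS₁₁ hS₁₂ S₂ hS₂₁ hS₂₂ W hW i hi, ?_⟩
  have key := aux_half n m hm r₂ T₂ R₂' r₁ T₁ R₁' hT₂ hR₂ hT₁ hR₁ S₂ hS₂₁ hS₂₂ S₁ hS₁₁ hS₁₂
    (ContinuousLinearMap.adjoint W) (fun j hj => by
      constructor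
      · have := congrArg ContinuousLinearMap.adjoint (hW j hj).2
        simpa [ContinuousLinearMap.adjoint_comp] using this.symm
      · have := congrArg ContinuousLinearMap.adjoint (hW j hj).1
        simpa [ContinuousLinearMap.adjoint_comp] using this.symm) i hi
  have := congrArg ContinuousLinearMap.adjoint key
  simpa [ContinuousLinearMap.adjoint_comp] using this.symm
end
end

section
/- Let n, m be integers with 2 ≤ n, m < ∞, H a complex Hilbert space, (r_1, …, r_m) a Cuntz family of order m on H with associated O_∞ family (T_j)_{j ≥ 1} and operators R_a, Q, and let (S_1, …, S_n) be the induced Cuntz family of order n. Then: (i) the associated O_∞ family of (S_1, …, S_n) coincides with (T_j)_{j ≥ 1}, i.e. S_n^k S_i = T_{(n−1)k+i} for all k ≥ 0 and i = 1, …, n−1; (ii) consequently, for every integer a ≥ 0 the operator R'_a built from the associated O_∞ family of (S_1, …, S_n) equals R_a, and Q' = Q. -/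
open Filter

noncomputable section

variable {H : Type*} [NormedAddCommGroup H] [InnerProductSpace ℂ H] [CompleteSpace H]

theorem assoc_shift (n : ℕ) (hn : 2 ≤ n) (S T : ℕ → H →L[ℂ] H) (h : IsAssocOInf n S T) (p : ℕ) :
    T (p + (n - 1)) = S (n - 1) * T p := by
  have hd : 0 < n - 1 := by omega
  have h1 := h (p / (n - 1)) (p % (n - 1)) (Nat.mod_lt _ hd)
  have h2 := h (p / (n - 1) + 1) (p % (n - 1)) (Nat.mod_lt _ hd)
  have e := Nat.div_add_mod p (n - 1)
  rw [e] at h1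
  rw [show (n - 1) * (p / (n - 1) + 1) + p % (n - 1) = p + (n - 1) by rw [mul_add]; omega] at h2
  rw [h2, h1, pow_succ', mul_assoc]

theorem assoc_base (n : ℕ) (S T : ℕ → H →L[ℂ] H) (h : IsAssocOInf n S T) (i : ℕ)
    (hi : i < n - 1) : T i = S i := by
  simpa using h 0 i hi

theorem assoc_orth (m : ℕ) (hm : 2 ≤ m) (r T : ℕ → H →L[ℂ] H) (hr : CuntzFamily m r)
    (hT : IsAssocOInf m r T) : OInfFamily T := by
  obtain ⟨ho, -⟩ := hr
  simp only [← ContinuousLinearMap.star_eq_adjoint] at ho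
  have key : ∀ i q, i < m - 1 → star (T i) * T (q + (m - 1)) = 0 := by
    intro i q hi
    rw [assoc_shift m hm r T hT, assoc_base m r T hT i hi, ← mul_assoc,
      ho i (by omega) (m - 1) (by omega), if_neg (by omega), zero_mul]
  intro i
  simp only [← ContinuousLinearMap.star_eq_adjoint]
  induction i using Nat.strong_induction_on with
  | _ i ih =>
    intro j
    by_cases hi : i < m - 1
    · by_cases hj : j < m - 1
      · rw [assoc_base m r T hT i hi, assoc_base m r T hT j hj]
        exact ho i (by omega) j (by omega)
      · obtain ⟨q, rfl⟩ := Nat.exists_eq_add_of_le' (not_lt.mp hj)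
        rw [key i q hi, if_neg (by omega)]
    · obtain ⟨p, rfl⟩ := Nat.exists_eq_add_of_le' (not_lt.mp hi)
      by_cases hj : j < m - 1
      · rw [if_neg (by omega)]
        have := congrArg star (key j p hj)
        simpa only [star_mul, star_star, star_zero] using this
      · obtain ⟨q, rfl⟩ := Nat.exists_eq_add_of_le' (not_lt.mp hj)
        rw [assoc_shift m hm r T hT p, assoc_shift m hm r T hT q, star_mul, mul_assoc,
          ← mul_assoc (star (r (m - 1))), ho (m - 1) (by omega) (m - 1) (by omega), if_pos rfl,
          one_mul, ih p (by omega) q]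
        simp

theorem sot_mul (T : ℕ → H →L[ℂ] H) (hT : OInfFamily T) (a : ℕ) (R : H →L[ℂ] H)
    (hR : IsSOTSum T a R) (p : ℕ) : R * T p = T (p + a) := by
  ext y
  refine tendsto_nhds_unique (hR (T p y)) ?_
  refine tendsto_const_nhds.congr' ?_
  filter_upwards [eventually_gt_atTop p] with N hN
  have h : ∀ j, (T (j + a) * ContinuousLinearMap.adjoint (T j)) (T p y)
      = if j = p then T (p + a) y else 0 := by
    intro j
    have := congrArg (fun A : H →L[ℂ] H => T (j + a) (A y)) (hT j p)
    simp only [ContinuousLinearMap.mul_apply] at this ⊢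
    rw [this]
    split_ifs with h
    · simp [h]
    · simp
  simp [h, hN]

theorem stmt12 (n m : ℕ) (hn : 2 ≤ n) (hm : 2 ≤ m)
    (r T : ℕ → H →L[ℂ] H) (hr : CuntzFamily m r) (hT : IsAssocOInf m r T)
    (R : ℕ → H →L[ℂ] H) (hR : ∀ a, IsSOTSum T a (R a))
    (S : ℕ → H →L[ℂ] H) (hS₁ : ∀ i < n - 1, S i = T i)
    (hS₂ : S (n - 1) = r (m - 1) * (1 - R 0) + R (n - 1)) :
    IsAssocOInf n S T ∧
    ∀ T' R' : ℕ → H →L[ℂ] H, IsAssocOInf n S T' → (∀ a, IsSOTSum T' a (R' a)) →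
      ∀ a, R' a = R a := by
  have hO := assoc_orth m hm r T hr hT
  have hstep : ∀ p, S (n - 1) * T p = T (p + (n - 1)) := by
    intro p
    rw [hS₂, add_mul, mul_assoc, sub_mul, sot_mul T hO 0 (R 0) (hR 0) p,
      sot_mul T hO (n - 1) _ (hR (n - 1)) p]
    simp
  have hA : IsAssocOInf n S T := by
    intro k i hi
    induction k with
    | zero => simp [hS₁ i hi]
    | succ k ih =>
      rw [pow_succ', mul_assoc, ← ih, hstep]
      congr 1
      ring
  refine ⟨hA, fun T' R' hT' hR' a => ?_⟩
  have hTT : T' = T := by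
    funext p
    have hd : 0 < n - 1 := by omega
    have h1 := hA (p / (n - 1)) (p % (n - 1)) (Nat.mod_lt _ hd)
    have h2 := hT' (p / (n - 1)) (p % (n - 1)) (Nat.mod_lt _ hd)
    rw [Nat.div_add_mod] at h1 h2
    rw [h1, h2]
  subst hTT
  ext x
  exact tendsto_nhds_unique (hR' a x) (hR a x)
end
end

section
/- Let m be an integer with 2 ≤ m < ∞, H a complex Hilbert space, and (r_1, …, r_m) a Cuntz family of order m on H. Then the induced Cuntz family of order m (i.e. taking n = m in the construction) equals (r_1, …, r_m): S_i = r_i for all i = 1, …, m. In particular, S_m = r_m(I − Q) + R_{m−1} = r_m. -/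
open Filter

noncomputable section

variable {H : Type*} [NormedAddCommGroup H] [InnerProductSpace ℂ H] [CompleteSpace H]

theorem stmt13 (m : ℕ) (hm : 2 ≤ m)
    (r T : ℕ → H →L[ℂ] H) (hr : CuntzFamily m r) (hT : IsAssocOInf m r T)
    (R : ℕ → H →L[ℂ] H) (hR : ∀ a, IsSOTSum T a (R a))
    (S : ℕ → H →L[ℂ] H) (hS₁ : ∀ i < m - 1, S i = T i)
    (hS₂ : S (m - 1) = r (m - 1) * (1 - R 0) + R (m - 1)) :
    (∀ i < m, S i = r i) ∧ r (m - 1) * (1 - R 0) + R (m - 1) = r (m - 1) := by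
  have hmain : r (m - 1) * (1 - R 0) + R (m - 1) = r (m - 1) := by
    have hshift : ∀ j, T (j + (m - 1)) = r (m - 1) * T j := by
      intro j
      have hpos : 0 < m - 1 := by omega
      have hlt := Nat.mod_lt j hpos
      have h1 := hT (j / (m - 1)) (j % (m - 1)) hlt
      have h2 := hT (j / (m - 1) + 1) (j % (m - 1)) hlt
      have e1 : (m - 1) * (j / (m - 1)) + j % (m - 1) = j := Nat.div_add_mod j (m - 1)
      have e2 : (m - 1) * (j / (m - 1) + 1) + j % (m - 1) = j + (m - 1) := by
        rw [Nat.mul_add, Nat.mul_one]; omega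
      rw [e1] at h1
      rw [e2] at h2
      rw [h2, h1, pow_succ', mul_assoc]
    have hRR : R (m - 1) = r (m - 1) * R 0 := by
      ext x
      have h1 := hR (m - 1) x
      have h2 := ((r (m - 1)).continuous.tendsto _).comp (hR 0 x)
      refine tendsto_nhds_unique h1 (h2.congr fun N => ?_)
      simp only [Function.comp_apply, map_sum]
      refine Finset.sum_congr rfl fun j _ => ?_
      rw [hshift j]
      rfl
    rw [hRR, mul_sub, mul_one, sub_add_cancel]
  refine ⟨fun i hi => ?_, hmain⟩
  by_cases h : i < m - 1
  · rw [hS₁ i h]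
    simpa using hT 0 i h
  · have : i = m - 1 := by omega
    rw [this, hS₂, hmain]
end
end

section
/- Let n be an integer with 2 ≤ n < ∞, H a nonzero complex Hilbert space, and (t_j)_{j ≥ 1} an O_∞ family on H, with operators R_a, Q. Define S_i := t_i for i = 1, …, n−1 and S_n := I − Q + R_{n−1}. Then (S_1, …, S_n) is a Cuntz family of order n on H, i.e. S_i* S_j = δ_{ij}·I for all i, j = 1, …, n and S_1 S_1* + ⋯ + S_n S_n* = I. -/
open Filter

noncomputable section

variable {H : Type*} [NormedAddCommGroup H] [InnerProductSpace ℂ H] [CompleteSpace H]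

theorem sot_key {t R : ℕ → H →L[ℂ] H} (hR : ∀ a, IsSOTSum t a (R a))
    (X Y : H →L[ℂ] H) (a b : ℕ) (h : ∀ j, X * t (j + a) = Y * t (j + b)) :
    X * R a = Y * R b := by
  ext x
  have h1 := (X.continuous.tendsto _).comp (hR a x)
  have h2 := (Y.continuous.tendsto _).comp (hR b x)
  refine tendsto_nhds_unique h1 (h2.congr fun N => ?_)
  simp only [Function.comp, map_sum]
  refine Finset.sum_congr rfl fun j _ => ?_
  exact (congrArg (fun T : H →L[ℂ] H => T (ContinuousLinearMap.adjoint (t j) x)) (h j)).symm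

theorem sot_apply {t R : ℕ → H →L[ℂ] H} (ht : OInfFamily t) (hR : ∀ a, IsSOTSum t a (R a))
    (a j : ℕ) : R a * t j = t (j + a) := by
  ext x
  refine tendsto_nhds_unique (hR a (t j x)) ?_
  refine tendsto_const_nhds.congr' ?_
  filter_upwards [eventually_gt_atTop j] with N hN
  have h : ∀ k, ContinuousLinearMap.adjoint (t k) (t j x) = if k = j then x else 0 := by
    intro k
    have := congrArg (fun T : H →L[ℂ] H => T x) (ht k j)
    simp only [mul_apply_eq_comp] at this
    rw [this]; split_ifs <;> simp
  rw [Finset.sum_eq_single j]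
  · simp [h]
  · intro k _ hk
    simp [h, hk]
  · intro hj
    simp [hN] at hj

theorem sot_adj {t R : ℕ → H →L[ℂ] H} (ht : OInfFamily t) (hR : ∀ a, IsSOTSum t a (R a))
    (j : ℕ) : ContinuousLinearMap.adjoint (t j) * R 0 = ContinuousLinearMap.adjoint (t j) := by
  ext x
  refine tendsto_nhds_unique
    (((ContinuousLinearMap.adjoint (t j)).continuous.tendsto _).comp (hR 0 x)) ?_
  refine tendsto_const_nhds.congr' ?_
  filter_upwards [eventually_gt_atTop j] with N hN
  have h : ∀ k y, ContinuousLinearMap.adjoint (t j) (t k y) = if j = k then y else 0 := by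
    intro k y
    have := congrArg (fun T : H →L[ℂ] H => T y) (ht j k)
    simp only [mul_apply_eq_comp] at this
    rw [this]; split_ifs <;> simp
  simp [h, hN]

theorem stmt17 [Nontrivial H] (n : ℕ) (hn : 2 ≤ n)
    (t : ℕ → H →L[ℂ] H) (ht : OInfFamily t)
    (R : ℕ → H →L[ℂ] H) (hR : ∀ a, IsSOTSum t a (R a))
    (S : ℕ → H →L[ℂ] H) (hS₁ : ∀ i < n - 1, S i = t i)
    (hS₂ : S (n - 1) = 1 - R 0 + R (n - 1)) :
    CuntzFamily n S := by
  obtain ⟨m, rfl⟩ : ∃ m, n = m + 1 := ⟨n - 1, by omega⟩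
  simp only [Nat.add_sub_cancel] at hS₁ hS₂
  unfold CuntzFamily
  unfold OInfFamily at ht
  have hRt := sot_apply ht hR
  have htQ := sot_adj ht hR
  have key := @sot_key H _ _ _ t R hR
  simp only [← ContinuousLinearMap.star_eq_adjoint] at *
  have htR : ∀ i, star (t (i + m)) * R m = star (t i) := by
    intro i
    rw [key _ (star (t i)) m 0 (fun j => by simp [ht]), htQ]
  have htR0 : ∀ i < m, star (t i) * R m = 0 := by
    intro i hi
    rw [key _ 0 m 0 (fun j => by rw [ht, if_neg (by omega), zero_mul]), zero_mul]
  have hQt : ∀ j, R 0 * t j = t j := fun j => hRt 0 j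
  have hQst : ∀ j, star (R 0) * t j = t j := fun j => by
    simpa using congrArg star (htQ j)
  have hQsQ : star (R 0) * R 0 = R 0 := by
    rw [key _ 1 0 0 (fun j => by simp [hQst]), one_mul]
  have hQs : star (R 0) = R 0 := by
    rw [← hQsQ, star_mul, star_star]
  have hQQ : R 0 * R 0 = R 0 := by rw [hQs] at hQsQ; exact hQsQ
  have hQR : R 0 * R m = R m := by
    rw [key _ 1 m m (fun j => by simp [hQt]), one_mul]
  have hRQ : R m * R 0 = R m := by
    rw [key _ 1 0 m (fun j => by simp [hRt]), one_mul]
  have hRst : ∀ j, star (R m) * t (j + m) = t j := fun j => by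
    simpa using congrArg star (htR j)
  have hRst0 : ∀ j < m, star (R m) * t j = 0 := fun j hj => by
    simpa using congrArg star (htR0 j hj)
  have hRR : star (R m) * R m = R 0 := by
    rw [key _ 1 m 0 (fun j => by simp [hRst]), one_mul]
  have hQRs : R 0 * star (R m) = star (R m) := by
    simpa [hQs] using congrArg star hRQ
  have hRsQ : star (R m) * R 0 = star (R m) := by
    simpa [hQs] using congrArg star hQR
  have hSs : star (S m) = 1 - R 0 + star (R m) := by
    rw [hS₂]; simp [hQs]
  have hSS : star (S m) * S m = 1 := by
    rw [hSs, hS₂]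
    simp only [mul_add, add_mul, mul_sub, sub_mul, mul_one, one_mul, hQQ, hQR, hRsQ, hRR]
    abel
  have htS : ∀ i < m, star (t i) * S m = 0 := by
    intro i hi
    rw [hS₂, mul_add, mul_sub, mul_one, htQ, htR0 i hi]; simp
  have hSt : ∀ i < m, star (S m) * t i = 0 := by
    intro i hi
    simpa using congrArg star (htS i hi)
  have hP : (R m * star (R m) + ∑ i ∈ Finset.range m, t i * star (t i)) = R 0 := by
    have h1 : (R m * star (R m) + ∑ i ∈ Finset.range m, t i * star (t i)) * R 0
        = 1 * R 0 := by
      refine key _ _ 0 0 (fun j => ?_)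
      rw [add_zero, one_mul, add_mul, Finset.sum_mul, mul_assoc]
      simp only [mul_assoc, ht]
      by_cases hj : j < m
      · rw [hRst0 j hj]; simp [hj]
      · obtain ⟨k, rfl⟩ : ∃ k, j = k + m := ⟨j - m, by omega⟩
        rw [hRst, hRt]; simp
    rw [add_mul, Finset.sum_mul, mul_assoc, hRsQ, one_mul] at h1
    simpa only [mul_assoc, htQ] using h1
  refine ⟨fun i hi j hj => ?_, ?_⟩
  · rcases Nat.lt_succ_iff_lt_or_eq.1 hi with hi | rfl <;>
    rcases Nat.lt_succ_iff_lt_or_eq.1 hj with hj | rfl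
    · rw [hS₁ i hi, hS₁ j hj, ht]
    · rw [hS₁ i hi, htS i hi, if_neg hi.ne]
    · rw [hS₁ j hj, hSt j hj, if_neg hj.ne']
    · rw [hSS, if_pos rfl]
  · rw [Finset.sum_range_succ, hSs, hS₂,
      Finset.sum_congr rfl (fun i hi => by rw [hS₁ i (Finset.mem_range.1 hi)])]
    simp only [mul_add, add_mul, mul_sub, sub_mul, mul_one, one_mul, hQQ, hQRs, hRQ]
    rw [← eq_sub_iff_add_eq'] at hP
    rw [hP]
    abel
end
end
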